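/- arXiv:1810.05207 — 3 statements merged into one kernel-verified Lean document; each statement's English description precedes it below -/
import Mathlib

section
/- Let Λ = N(0,1) be the standard Gaussian measure on ℝ and define A_{3,n} = (∫_ℝ |ω|^{3n} dΛ(ω)) / ( sqrt(∫_ℝ |ω|⁶ dΛ(ω)) )^n = (3n−1)!!/15^{n/2} for even n. Then for every constant K ≥ 1 there exists an even integer n ≥ 2 such that A_{3,n} > (n!/2)·K^{n−2}. Hence the Bernstein condition cannot hold for the Gaussian measure with third-order weight r = p+q = 3. -/
open MeasureTheory Real ProbabilityTheory

lemma gauss_moment (k : ℕ) : ∫ ω, |ω| ^ (2 * k) ∂(gaussianReal 0 1) =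
    (Nat.doubleFactorial (2 * k - 1) : ℝ) := by
  rw [integral_gaussianReal_eq_integral_smul (by norm_num)]
  have h1 : ∀ x : ℝ, gaussianPDFReal 0 1 x • |x| ^ (2 * k) =
      (fun y : ℝ => (√(2 * π))⁻¹ * (y ^ ((2 * k : ℕ) : ℝ) * rexp (-(1/2) * y ^ (2:ℝ)))) |x| := by
    intro x
    simp only [gaussianPDFReal, smul_eq_mul, rpow_natCast, rpow_two, sq_abs, NNReal.coe_one,
      mul_one, sub_zero]
    rw [show -x ^ 2 / 2 = -(1/2) * x ^ 2 by ring]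
    ring
  rw [integral_congr_ae (ae_of_all _ h1), integral_comp_abs (f := fun y : ℝ =>
      (√(2 * π))⁻¹ * (y ^ ((2 * k : ℕ) : ℝ) * rexp (-(1/2) * y ^ (2:ℝ)))), integral_const_mul,
    integral_rpow_mul_exp_neg_mul_rpow (by norm_num) (lt_of_lt_of_le (by norm_num) (Nat.cast_nonneg _)) (by norm_num)]
  have h2 : (((2 * k : ℕ) : ℝ) + 1) / 2 = k + 1 / 2 := by push_cast; ring
  have h3 : (1 / 2 : ℝ) ^ (-(((2 * k : ℕ) : ℝ) + 1) / 2) = 2 ^ k * √2 := by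
    rw [neg_div, h2, one_div, inv_rpow (by norm_num), rpow_neg (by norm_num), inv_inv,
      rpow_add (by norm_num), rpow_natCast, sqrt_eq_rpow, one_div]
  rw [h3, h2, Real.Gamma_nat_add_half, Real.sqrt_mul (by norm_num)]
  have h4 : √π ≠ 0 := by positivity
  field_simp

lemma dfact_ge (m : ℕ) : (2 * m).factorial * m.factorial ≤ Nat.doubleFactorial (6 * m - 1) := by
  induction m with
  | zero => simp
  | succ m ih =>
    have e : Nat.doubleFactorial (6 * (m + 1) - 1) =
        (6 * m + 5) * ((6 * m + 3) * ((6 * m + 1) * Nat.doubleFactorial (6 * m - 1))) := by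
      rw [show 6 * (m + 1) - 1 = 6 * m + 1 + 2 + 2 by omega, Nat.doubleFactorial_add_two,
        Nat.doubleFactorial_add_two, Nat.doubleFactorial_add_one]
    rw [e, show 2 * (m + 1) = 2 * m + 1 + 1 by ring, Nat.factorial_succ, Nat.factorial_succ,
      Nat.factorial_succ]
    calc _ = (2 * m + 1 + 1) * ((2 * m + 1) * ((m + 1) * ((2 * m).factorial * m.factorial))) := by
          ring
      _ ≤ _ := by
          have h1 : 2 * m + 1 + 1 ≤ 6 * m + 5 := by omega
          have h2 : 2 * m + 1 ≤ 6 * m + 3 := by omega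
          have h3 : m + 1 ≤ 6 * m + 1 := by omega
          gcongr

theorem gaussian_bernstein_fails_third_order :
    ∀ K : ℝ, 1 ≤ K → ∃ n : ℕ, 2 ≤ n ∧ Even n ∧
      (∫ ω, |ω| ^ (3 * n) ∂(gaussianReal 0 1)) /
          Real.sqrt (∫ ω, |ω| ^ 6 ∂(gaussianReal 0 1)) ^ n =
        (Nat.doubleFactorial (3 * n - 1) : ℝ) / (15 : ℝ) ^ ((n : ℝ) / 2) ∧
      (n.factorial : ℝ) / 2 * K ^ (n - 2) <
        (∫ ω, |ω| ^ (3 * n) ∂(gaussianReal 0 1)) /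
          Real.sqrt (∫ ω, |ω| ^ 6 ∂(gaussianReal 0 1)) ^ n := by
  intro K hK
  obtain ⟨m, hm, hm1⟩ := (((FloorSemiring.tendsto_pow_div_factorial_atTop (15 * K ^ 2)).eventually
    (gt_mem_nhds zero_lt_one)).and (Filter.eventually_ge_atTop 1)).exists
  have h6 : ∫ ω, |ω| ^ 6 ∂(gaussianReal 0 1) = 15 := by
    rw [gauss_moment 3]; norm_num [Nat.doubleFactorial]
  have hn : ∫ ω, |ω| ^ (3 * (2 * m)) ∂(gaussianReal 0 1) =
      (Nat.doubleFactorial (3 * (2 * m) - 1) : ℝ) := by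
    rw [show 3 * (2 * m) = 2 * (3 * m) by ring, gauss_moment]
  have hs : √(15:ℝ) ^ (2 * m) = 15 ^ m := by
    rw [pow_mul, Real.sq_sqrt (by norm_num)]
  refine ⟨2 * m, by omega, even_two_mul m, ?_, ?_⟩
  · rw [h6, hn, hs]
    congr 1
    rw [← rpow_natCast]
    congr 1
    push_cast
    ring
  · rw [h6, hn, hs, lt_div_iff₀ (by positivity)]
    have hf : (0:ℝ) < m.factorial := by positivity
    have hf2 : (0:ℝ) < (2 * m).factorial := by positivity
    rw [div_lt_one hf] at hm
    have hd : ((2 * m).factorial : ℝ) * m.factorial ≤ Nat.doubleFactorial (3 * (2 * m) - 1) := by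
      rw [show 3 * (2 * m) = 6 * m by ring]
      exact_mod_cast dfact_ge m
    have hp : K ^ (2 * m - 2) ≤ K ^ (2 * m) := pow_le_pow_right₀ hK (by omega)
    have hp0 : 0 < K ^ (2 * m) := by positivity
    refine lt_of_lt_of_le ?_ hd
    calc _ ≤ ((2 * m).factorial : ℝ) / 2 * K ^ (2 * m) * 15 ^ m := by gcongr
      _ = ((2 * m).factorial : ℝ) * ((15 * K ^ 2) ^ m / 2) := by rw [mul_pow, ← pow_mul]; ring
      _ < _ := by
        apply mul_lt_mul_of_pos_left _ hf2
        have : 0 < (15 * K ^ 2) ^ m := by positivity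
        linarith
end

section
/- Let Λ = N(0,1) be the standard Gaussian measure on ℝ and define A_{4,n} = (∫_ℝ |ω|^{4n} dΛ(ω)) / ( sqrt(∫_ℝ |ω|⁸ dΛ(ω)) )^n = (4n−1)!!/105^{n/2}. Then for every constant K ≥ 1 there exists an integer n ≥ 2 such that A_{4,n} > (n!/2)·K^{n−2}. Hence the Bernstein condition cannot hold for the Gaussian measure with fourth-order weight r = p+q = 4. -/
open MeasureTheory Real ProbabilityTheory

lemma aux_moment (m : ℕ) :
    ∫ ω, |ω| ^ (2 * m) ∂(gaussianReal 0 1) = (Nat.doubleFactorial (2 * m - 1) : ℝ) := by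
  rw [integral_gaussianReal_eq_integral_smul (by norm_num)]
  have h1 : ∀ x : ℝ, gaussianPDFReal 0 1 x • |x| ^ (2 * m)
      = (fun y : ℝ => (√(2 * π))⁻¹ * (y ^ ((2 * m : ℕ) : ℝ) * rexp (-(1 / 2) * y ^ (2 : ℝ)))) |x| := by
    intro x
    simp only [gaussianPDFReal, smul_eq_mul, Real.rpow_natCast, Real.rpow_two, sq_abs]
    simp only [NNReal.coe_one, mul_one, sub_zero]
    rw [show -(1 / 2) * x ^ 2 = -x ^ 2 / 2 by ring]
    ring
  simp_rw [h1]
  rw [integral_comp_abs (f := fun y : ℝ => (√(2 * π))⁻¹ * (y ^ ((2 * m : ℕ) : ℝ) * rexp (-(1 / 2) * y ^ (2 : ℝ)))),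
    integral_const_mul, integral_rpow_mul_exp_neg_mul_rpow (by norm_num)
      (by have : (0 : ℝ) ≤ ((2 * m : ℕ) : ℝ) := by positivity
          linarith) (by norm_num)]
  have h2 : (((2 * m : ℕ) : ℝ) + 1) / 2 = m + 1 / 2 := by push_cast; ring
  rw [neg_div, h2, Real.Gamma_nat_add_half]
  have h3 : (1 / 2 : ℝ) ^ (-((m : ℝ) + 1 / 2)) = 2 ^ m * √2 := by
    rw [one_div, Real.inv_rpow (by norm_num), ← Real.rpow_neg (by norm_num), neg_neg,
      Real.rpow_add (by norm_num), Real.rpow_natCast, Real.sqrt_eq_rpow]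
    norm_num
  rw [h3, Real.sqrt_mul (by norm_num)]
  have : √π ≠ 0 := by positivity
  have : √(2 : ℝ) ≠ 0 := by positivity
  field_simp

lemma aux_growth (n : ℕ) : n.factorial * n.factorial ≤ Nat.doubleFactorial (4 * n - 1) := by
  induction n with
  | zero => simp
  | succ n ih =>
    rcases Nat.eq_zero_or_pos n with rfl | hn
    · simp [Nat.doubleFactorial]
    · obtain ⟨k, hk⟩ : ∃ k, 4 * n = k + 1 := ⟨4 * n - 1, by omega⟩
      have e : 4 * (n + 1) - 1 = (k + 2) + 2 := by omega
      rw [e, Nat.doubleFactorial_add_two, Nat.doubleFactorial_add_two, Nat.factorial_succ]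
      have e2 : 4 * n - 1 = k := by omega
      rw [e2] at ih
      calc (n + 1) * n.factorial * ((n + 1) * n.factorial)
          = (n + 1) * ((n + 1) * (n.factorial * n.factorial)) := by ring
        _ ≤ (k + 2 + 2) * ((k + 2) * Nat.doubleFactorial k) := by
          gcongr <;> omega

/-- The Bernstein condition fails for the standard Gaussian with fourth-order weight
`r = 4`: for every `K ≥ 1` there is an `n ≥ 2` with
`A_{4,n} = (∫|ω|^{4n} dΛ)/(√(∫|ω|⁸ dΛ))^n = (4n−1)!!/105^{n/2} > (n!/2)·K^{n−2}`. -/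
theorem gaussian_bernstein_fails_fourth_order :
    ∀ K : ℝ, 1 ≤ K → ∃ n : ℕ, 2 ≤ n ∧
      (∫ ω, |ω| ^ (4 * n) ∂(gaussianReal 0 1)) /
          Real.sqrt (∫ ω, |ω| ^ 8 ∂(gaussianReal 0 1)) ^ n =
        (Nat.doubleFactorial (4 * n - 1) : ℝ) / (105 : ℝ) ^ ((n : ℝ) / 2) ∧
      (n.factorial : ℝ) / 2 * K ^ (n - 2) <
        (∫ ω, |ω| ^ (4 * n) ∂(gaussianReal 0 1)) /
          Real.sqrt (∫ ω, |ω| ^ 8 ∂(gaussianReal 0 1)) ^ n := by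
  intro K hK
  have hlim := FloorSemiring.tendsto_pow_div_factorial_atTop (11 * K)
  obtain ⟨n, hn, hn2⟩ := ((hlim.eventually_lt_const zero_lt_one).and
    (Filter.eventually_ge_atTop 2)).exists
  have h8 : ∫ ω, |ω| ^ 8 ∂(gaussianReal 0 1) = (105 : ℝ) := by
    have := aux_moment 4
    norm_num [Nat.doubleFactorial] at this ⊢
    exact this
  have h4 : ∫ ω, |ω| ^ (4 * n) ∂(gaussianReal 0 1) = (Nat.doubleFactorial (4 * n - 1) : ℝ) := by
    have := aux_moment (2 * n)
    rwa [show 2 * (2 * n) = 4 * n by ring] at this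
  refine ⟨n, hn2, ?_, ?_⟩
  · rw [h8, h4, Real.sqrt_eq_rpow, ← Real.rpow_natCast, ← Real.rpow_mul (by norm_num)]
    congr 2
    ring
  · rw [h8, h4, lt_div_iff₀ (by positivity)]
    have hf : (0 : ℝ) < n.factorial := by positivity
    rw [div_lt_one hf] at hn
    have hg : (n.factorial : ℝ) * n.factorial ≤ (Nat.doubleFactorial (4 * n - 1) : ℝ) := by
      exact_mod_cast aux_growth n
    have hs : √(105 : ℝ) ≤ 11 := by
      rw [Real.sqrt_le_left (by norm_num)]; norm_num
    calc (n.factorial : ℝ) / 2 * K ^ (n - 2) * √105 ^ n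
        ≤ n.factorial * K ^ n * 11 ^ n := by
          gcongr
          · linarith
          · omega
      _ = n.factorial * (11 * K) ^ n := by rw [mul_pow]; ring
      _ < n.factorial * n.factorial := by gcongr
      _ ≤ _ := hg
end

section
/- Let ℓ ∈ ℕ⁺ and let Λ be the probability measure on ℝ with density (ℓ/Γ(1/(2ℓ)))·e^{−ω^{2ℓ}}. Then for every r ∈ ℕ⁺ with r ≤ 2ℓ there exists a constant K ≥ 1 such that for all integers n ≥ 2, A_{r,n}(Λ) := (∫_ℝ |ω|^{rn} dΛ(ω)) / ( sqrt(∫_ℝ |ω|^{2r} dΛ(ω)) )^n ≤ (n!/2)·K^{n−2}. That is, the Bernstein condition holds for derivative orders r up to 2ℓ for kernels whose spectral density is proportional to e^{−ω^{2ℓ}}. -/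
open MeasureTheory Real

/-- The probability measure on `ℝ` with density `(ℓ/Γ(1/(2ℓ)))·e^{−ω^{2ℓ}}`. -/
noncomputable def specMeasure (ℓ : ℕ) : Measure ℝ :=
  (volume : Measure ℝ).withDensity
    fun ω => ENNReal.ofReal
      (((ℓ : ℝ) / Real.Gamma (1 / (2 * (ℓ : ℝ)))) * Real.exp (-(ω ^ (2 * ℓ))))

lemma sq_sub_one_le_pow (ℓ : ℕ) (hℓ : 0 < ℓ) (ω : ℝ) : ω ^ 2 - 1 ≤ ω ^ (2 * ℓ) := by
  rw [pow_mul]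
  have h0 : 0 ≤ ω ^ 2 := sq_nonneg ω
  rcases le_total 1 (ω ^ 2) with h | h
  · have := le_self_pow₀ h hℓ.ne'
    linarith
  · have : 0 ≤ (ω ^ 2) ^ ℓ := by positivity
    linarith

lemma integrable_half_exp (ℓ : ℕ) (hℓ : 0 < ℓ) :
    Integrable (fun ω : ℝ => Real.exp (ω ^ (2 * ℓ) / 2)) (specMeasure ℓ) := by
  unfold specMeasure
  rw [integrable_withDensity_iff (by fun_prop) (by simp)]
  have hc : 0 ≤ (ℓ : ℝ) / Real.Gamma (1 / (2 * (ℓ : ℝ))) :=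
    div_nonneg (by positivity) (Real.Gamma_nonneg_of_nonneg (by positivity))
  set c := (ℓ : ℝ) / Real.Gamma (1 / (2 * (ℓ : ℝ))) with hcdef
  have hdom : Integrable (fun ω : ℝ => (c * Real.exp (1 / 2)) * Real.exp (-(1 / 2) * ω ^ 2)) :=
    (integrable_exp_neg_mul_sq (by norm_num : (0 : ℝ) < 1 / 2)).const_mul _
  refine hdom.mono' (by fun_prop) (Filter.Eventually.of_forall fun ω => ?_)
  rw [ENNReal.toReal_ofReal (by positivity), Real.norm_of_nonneg (by positivity)]
  have h1 : Real.exp (ω ^ (2 * ℓ) / 2) * (c * Real.exp (-ω ^ (2 * ℓ)))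
      = c * Real.exp (ω ^ (2 * ℓ) / 2 + -ω ^ (2 * ℓ)) := by
    rw [Real.exp_add]; ring
  rw [h1, mul_assoc, ← Real.exp_add]
  have := sq_sub_one_le_pow ℓ hℓ ω
  exact mul_le_mul_of_nonneg_left (Real.exp_le_exp.mpr (by linarith)) hc

lemma abs_pow_le_exp (ℓ r n : ℕ) (hr : r ≤ 2 * ℓ) (ω : ℝ) :
    |ω| ^ (r * n) ≤ (n.factorial : ℝ) * 2 ^ n * (2 * Real.exp (ω ^ (2 * ℓ) / 2)) := by
  have hx : 0 ≤ ω ^ (2 * ℓ) := by rw [pow_mul]; positivity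
  have hf : (1 : ℝ) ≤ n.factorial := by exact_mod_cast Nat.one_le_iff_ne_zero.mpr n.factorial_ne_zero
  have h2 : (1 : ℝ) ≤ 2 ^ n := one_le_pow₀ (by norm_num)
  have he : 1 ≤ Real.exp (ω ^ (2 * ℓ) / 2) := Real.one_le_exp (by positivity)
  have hfe : 1 ≤ (n.factorial : ℝ) * 2 ^ n := by nlinarith
  rcases le_total |ω| 1 with h | h
  · have h1 : |ω| ^ (r * n) ≤ 1 := pow_le_one₀ (abs_nonneg _) h
    nlinarith
  · have h1 : |ω| ^ (r * n) ≤ |ω| ^ (2 * ℓ * n) := pow_le_pow_right₀ h (by gcongr)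
    have h3 : |ω| ^ (2 * ℓ * n) = (ω ^ (2 * ℓ)) ^ n := by
      rw [pow_mul, pow_mul |ω|, sq_abs, ← pow_mul ω]
    have h4 := Real.pow_div_factorial_le_exp (ω ^ (2 * ℓ) / 2) (by positivity) n
    rw [div_pow, div_div, div_le_iff₀ (by positivity)] at h4
    have h5 : 0 ≤ (n.factorial : ℝ) * 2 ^ n * Real.exp (ω ^ (2 * ℓ) / 2) := by positivity
    rw [h3] at h1
    nlinarith

/-- For a spectral density proportional to `e^{−ω^{2ℓ}}`, the Bernstein condition holds for
all derivative orders `r ≤ 2ℓ`: there is a constant `K ≥ 1` with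
`A_{r,n} = (∫|ω|^{rn} dΛ)/(√(∫|ω|^{2r} dΛ))^n ≤ (n!/2)·K^{n−2}` for all `n ≥ 2`. -/
theorem bernstein_higher_order (ℓ : ℕ) (hℓ : 0 < ℓ) :
    ∀ r : ℕ, 1 ≤ r → r ≤ 2 * ℓ →
      ∃ K : ℝ, 1 ≤ K ∧ ∀ n : ℕ, 2 ≤ n →
        (∫ ω, |ω| ^ (r * n) ∂(specMeasure ℓ)) /
            Real.sqrt (∫ ω, |ω| ^ (2 * r) ∂(specMeasure ℓ)) ^ n ≤
          (n.factorial : ℝ) / 2 * K ^ (n - 2) := by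
  intro r hr1 hr
  set M : ℝ := ∫ ω, 2 * Real.exp (ω ^ (2 * ℓ) / 2) ∂(specMeasure ℓ) with hM
  have hM0 : 0 ≤ M := integral_nonneg fun ω => by positivity
  set I : ℝ := ∫ ω, |ω| ^ (2 * r) ∂(specMeasure ℓ) with hI
  have hI0 : 0 ≤ I := integral_nonneg fun ω => by positivity
  set s : ℝ := (Real.sqrt I)⁻¹ with hs
  have hs0 : 0 ≤ s := by positivity
  set C : ℝ := 1 + 2 * (M + 1) * s with hC
  have hC1 : 1 ≤ C := by
    have : 0 ≤ 2 * (M + 1) * s := by positivity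
    linarith
  have hK : 1 ≤ 2 * C ^ 3 := by
    have : 1 ≤ C ^ 3 := one_le_pow₀ hC1
    linarith
  refine ⟨2 * C ^ 3, hK, fun n hn => ?_⟩
  rcases hn.eq_or_lt with rfl | hn3
  · rw [Real.sq_sqrt hI0, mul_comm r 2]
    simpa using div_self_le_one I
  have hmom : ∫ ω, |ω| ^ (r * n) ∂(specMeasure ℓ) ≤ (n.factorial : ℝ) * 2 ^ n * M := by
    rw [hM, ← integral_const_mul]
    exact integral_mono_of_nonneg (Filter.Eventually.of_forall fun ω => by positivity)
      (((integrable_half_exp ℓ hℓ).const_mul 2).const_mul _)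
      (Filter.Eventually.of_forall fun ω => abs_pow_le_exp ℓ r n hr ω)
  have hMn : M ≤ (M + 1) ^ n :=
    (by linarith : M ≤ M + 1).trans (le_self_pow₀ (by linarith) (by omega))
  have hpow : 2 * C ^ n ≤ (2 * C ^ 3) ^ (n - 2) := by
    rw [mul_pow, ← pow_mul]
    have h1 : (2 : ℝ) ≤ 2 ^ (n - 2) := le_self_pow₀ (by norm_num) (by omega)
    have h2 : C ^ n ≤ C ^ (3 * (n - 2)) := pow_le_pow_right₀ hC1 (by omega)
    gcongr
  calc _ = (∫ ω, |ω| ^ (r * n) ∂(specMeasure ℓ)) * s ^ n := by rw [hs, inv_pow, div_eq_mul_inv]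
    _ ≤ (n.factorial : ℝ) * 2 ^ n * (M + 1) ^ n * s ^ n := by
      gcongr
      exact hmom.trans (by gcongr)
    _ = (n.factorial : ℝ) * (2 * (M + 1) * s) ^ n := by rw [mul_pow, mul_pow]; ring
    _ ≤ (n.factorial : ℝ) * C ^ n := by
      gcongr
      linarith
    _ = (n.factorial : ℝ) / 2 * (2 * C ^ n) := by ring
    _ ≤ _ := by gcongr
end
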